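/- Let d ≥ 1. Let C be a real symmetric positive semidefinite d×d matrix with eigenvalues λ₁ ≥ λ₂ ≥ ⋯ ≥ λ_d ≥ 0, and let E = diag(μ₁, …, μ_d) be a real diagonal d×d matrix with 0 ≤ μ₁ ≤ μ₂ ≤ ⋯ ≤ μ_d. Then the minimum of tr(Rᵀ C R E) over all real orthogonal d×d matrices R exists and equals Σ_{i=1}^d λ_i μ_i, i.e., the sum of the descending eigenvalues of C paired with the ascending diagonal entries of E. -/

import Mathlib

open Matrix Finset

/-- A doubly stochastic pairing of two antivarying families is at least the direct pairing. -/
theorem Antivary.sum_mul_le_sum_sum_of_mem_doublyStochastic {n : Type*} [Fintype n]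
    [DecidableEq n] {f g : n → ℝ} (hfg : Antivary f g) {M : Matrix n n ℝ}
    (hM : M ∈ doublyStochastic ℝ n) :
    ∑ i, f i * g i ≤ ∑ i, ∑ j, M i j * (f i * g j) := by
  obtain ⟨w, hw0, hw1, rfl⟩ := exists_eq_sum_perm_of_mem_doublyStochastic hM
  have key : ∑ i, ∑ j, (∑ σ : Equiv.Perm n, w σ • σ.permMatrix ℝ) i j * (f i * g j) =
      ∑ σ : Equiv.Perm n, w σ * ∑ i, f i * g (σ i) := by
    simp only [Matrix.sum_apply, Matrix.smul_apply, Finset.sum_mul, Finset.mul_sum]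
    simp_rw [Finset.sum_comm (s := (Finset.univ : Finset n))
      (t := (Finset.univ : Finset (Equiv.Perm n)))]
    refine Finset.sum_congr rfl fun σ _ => Finset.sum_congr rfl fun i _ => ?_
    simp [Equiv.Perm.permMatrix, PEquiv.toMatrix_apply, Equiv.toPEquiv_apply]
  rw [key]
  calc ∑ i, f i * g i = ∑ σ : Equiv.Perm n, w σ * ∑ i, f i * g i := by
        rw [← Finset.sum_mul, hw1, one_mul]
    _ ≤ _ := Finset.sum_le_sum fun σ _ =>
        mul_le_mul_of_nonneg_left hfg.sum_mul_le_sum_mul_comp_perm (hw0 σ)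

/-- The entrywise squares of a real orthogonal matrix form a doubly stochastic matrix. -/
theorem Matrix.of_sq_mem_doublyStochastic {n : Type*} [Fintype n] [DecidableEq n]
    {Q : Matrix n n ℝ} (hQ : Qᵀ * Q = 1) :
    Matrix.of (fun i j => Q i j ^ 2) ∈ doublyStochastic ℝ n := by
  have hQ' : Q * Qᵀ = 1 := mul_eq_one_comm.mp hQ
  refine mem_doublyStochastic_iff_sum.mpr ⟨fun i j => sq_nonneg _, fun i => ?_, fun j => ?_⟩
  · simpa [Matrix.mul_apply, sq] using congrFun (congrFun hQ' i) i
  · simpa [Matrix.mul_apply, sq] using congrFun (congrFun hQ j) j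

/-- The trace of `Qᵀ diag(f) Q diag(g)` in terms of the squared entries of `Q`. -/
theorem Matrix.trace_transpose_mul_diagonal_mul_mul_diagonal {n : Type*} [Fintype n]
    [DecidableEq n] (Q : Matrix n n ℝ) (f g : n → ℝ) :
    (Qᵀ * Matrix.diagonal f * Q * Matrix.diagonal g).trace =
      ∑ i, ∑ j, Q i j ^ 2 * (f i * g j) := by
  rw [Finset.sum_comm]
  refine Finset.sum_congr rfl fun j _ => ?_
  rw [Matrix.diag_apply, Matrix.mul_diagonal, Matrix.mul_apply, Finset.sum_mul]
  simp only [Matrix.mul_diagonal, Matrix.transpose_apply]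
  exact Finset.sum_congr rfl fun i _ => by ring

/-- The minimum of `tr(Rᵀ C R E)` over orthogonal `R` exists and equals
`∑ i, λ i * μ i`, pairing descending eigenvalues of `C` with ascending entries of `E`. -/
theorem oscar_rotation_min_value (d : ℕ) (hd : 1 ≤ d)
    (C U : Matrix (Fin d) (Fin d) ℝ) (lam mu : Fin d → ℝ)
    (hC : C.PosSemidef)
    (hU : Uᵀ * U = 1)
    (hdecomp : C = U * Matrix.diagonal lam * Uᵀ)
    (hlam : ∀ i j : Fin d, i ≤ j → lam j ≤ lam i)
    (hlam0 : ∀ i, 0 ≤ lam i)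
    (hmu : ∀ i j : Fin d, i ≤ j → mu i ≤ mu j)
    (hmu0 : ∀ i, 0 ≤ mu i) :
    IsLeast {x : ℝ | ∃ R : Matrix (Fin d) (Fin d) ℝ, Rᵀ * R = 1 ∧
        x = (Rᵀ * C * R * Matrix.diagonal mu).trace}
      (∑ i, lam i * mu i) := by
  subst hdecomp
  have hU' : U * Uᵀ = 1 := mul_eq_one_comm.mp hU
  refine ⟨⟨U, hU, ?_⟩, ?_⟩
  · have h : Uᵀ * (U * Matrix.diagonal lam * Uᵀ) * U = Matrix.diagonal lam := by
      calc _ = (Uᵀ * U) * Matrix.diagonal lam * (Uᵀ * U) := by simp only [Matrix.mul_assoc]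
        _ = _ := by rw [hU, one_mul, mul_one]
    rw [h, Matrix.diagonal_mul_diagonal, Matrix.trace_diagonal]
  · rintro x ⟨R, hR, rfl⟩
    have hQ : (Uᵀ * R)ᵀ * (Uᵀ * R) = 1 := by
      calc _ = Rᵀ * (U * Uᵀ) * R := by
            simp only [Matrix.transpose_mul, Matrix.transpose_transpose, Matrix.mul_assoc]
        _ = 1 := by rw [hU', mul_one, hR]
    have h : Rᵀ * (U * Matrix.diagonal lam * Uᵀ) * R =
        (Uᵀ * R)ᵀ * Matrix.diagonal lam * (Uᵀ * R) := by
      simp only [Matrix.transpose_mul, Matrix.transpose_transpose, Matrix.mul_assoc]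
    have hanti : Antivary lam mu := Antitone.antivary (fun i j hij => hlam i j hij)
      (fun i j hij => hmu i j hij)
    rw [h, Matrix.trace_transpose_mul_diagonal_mul_mul_diagonal]
    exact hanti.sum_mul_le_sum_sum_of_mem_doublyStochastic (Matrix.of_sq_mem_doublyStochastic hQ)
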